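/- If u solves the cylindrical Helmholtz equation with parameter k, then the function X₇u : (r,θ,z) ↦ z·sin θ · u_r(r,θ,z) + (z·cos θ / r) · u_θ(r,θ,z) − r·sin θ · u_z(r,θ,z) also solves the cylindrical Helmholtz equation with parameter k on the region r > 0. (Infinitesimal invariance under the symmetry generator X₇ = z sin θ ∂_r + (z cos θ / r) ∂_θ − r sin θ ∂_z of Theorem 1.) -/

import Mathlib

/-- Partial derivative with respect to the first argument. -/
noncomputable def p1 (u : ℝ → ℝ → ℝ → ℝ) (r θ z : ℝ) : ℝ :=
  deriv (fun s => u s θ z) r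

/-- Partial derivative with respect to the second argument. -/
noncomputable def p2 (u : ℝ → ℝ → ℝ → ℝ) (r θ z : ℝ) : ℝ :=
  deriv (fun s => u r s z) θ

/-- Partial derivative with respect to the third argument. -/
noncomputable def p3 (u : ℝ → ℝ → ℝ → ℝ) (r θ z : ℝ) : ℝ :=
  deriv (fun s => u r θ s) z

/-- The cylindrical Helmholtz equation holds at the point `(r, θ, z)`:
`u_rr + (1/r)·u_r + (1/r²)·u_θθ + u_zz + k²·u = 0`. -/
def CHEat (k : ℝ) (u : ℝ → ℝ → ℝ → ℝ) (r θ z : ℝ) : Prop :=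
  p1 (p1 u) r θ z + (1 / r) * p1 u r θ z + (1 / r ^ 2) * p2 (p2 u) r θ z
    + p3 (p3 u) r θ z + k ^ 2 * u r θ z = 0

/-- `u` is a smooth function solving the cylindrical Helmholtz equation with
parameter `k` (at every point with `r > 0`). -/
def SolvesCHE (k : ℝ) (u : ℝ → ℝ → ℝ → ℝ) : Prop :=
  ContDiff ℝ (⊤ : ℕ∞) (fun p : ℝ × ℝ × ℝ => u p.1 p.2.1 p.2.2) ∧
    ∀ r θ z : ℝ, 0 < r → CHEat k u r θ z



def Sm (u : ℝ → ℝ → ℝ → ℝ) : Prop :=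
  ContDiff ℝ (⊤ : ℕ∞) (fun p : ℝ × ℝ × ℝ => u p.1 p.2.1 p.2.2)

lemma Sm.has1 {u : ℝ → ℝ → ℝ → ℝ} (h : Sm u) (r θ z : ℝ) :
    HasDerivAt (fun s => u s θ z)
      (fderiv ℝ (fun p : ℝ × ℝ × ℝ => u p.1 p.2.1 p.2.2) (r, θ, z) (1, 0, 0)) r := by
  have h1 := (h.differentiable (by simp) (r, θ, z)).hasFDerivAt
  have h2 : HasDerivAt (fun s : ℝ => (s, θ, z)) ((1 : ℝ), (0 : ℝ), (0 : ℝ)) r :=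
    (hasDerivAt_id r).prodMk ((hasDerivAt_const r θ).prodMk (hasDerivAt_const r z))
  exact HasFDerivAt.comp_hasDerivAt r h1 h2

lemma Sm.has2 {u : ℝ → ℝ → ℝ → ℝ} (h : Sm u) (r θ z : ℝ) :
    HasDerivAt (fun s => u r s z)
      (fderiv ℝ (fun p : ℝ × ℝ × ℝ => u p.1 p.2.1 p.2.2) (r, θ, z) (0, 1, 0)) θ := by
  have h1 := (h.differentiable (by simp) (r, θ, z)).hasFDerivAt
  have h2 : HasDerivAt (fun s : ℝ => (r, s, z)) ((0 : ℝ), (1 : ℝ), (0 : ℝ)) θ :=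
    (hasDerivAt_const θ r).prodMk ((hasDerivAt_id θ).prodMk (hasDerivAt_const θ z))
  exact HasFDerivAt.comp_hasDerivAt θ h1 h2

lemma Sm.has3 {u : ℝ → ℝ → ℝ → ℝ} (h : Sm u) (r θ z : ℝ) :
    HasDerivAt (fun s => u r θ s)
      (fderiv ℝ (fun p : ℝ × ℝ × ℝ => u p.1 p.2.1 p.2.2) (r, θ, z) (0, 0, 1)) z := by
  have h1 := (h.differentiable (by simp) (r, θ, z)).hasFDerivAt
  have h2 : HasDerivAt (fun s : ℝ => (r, θ, s)) ((0 : ℝ), (0 : ℝ), (1 : ℝ)) z :=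
    (hasDerivAt_const z r).prodMk ((hasDerivAt_const z θ).prodMk (hasDerivAt_id z))
  exact HasFDerivAt.comp_hasDerivAt z h1 h2

lemma dir_smooth {F : ℝ × ℝ × ℝ → ℝ} (h : ContDiff ℝ (⊤ : ℕ∞) F) (v : ℝ × ℝ × ℝ) :
    ContDiff ℝ (⊤ : ℕ∞) (fun p => fderiv ℝ F p v) :=
  (h.fderiv_right (m := (⊤ : ℕ∞)) (by simp)).clm_apply contDiff_const

lemma dir_comm {F : ℝ × ℝ × ℝ → ℝ} (h : ContDiff ℝ (⊤ : ℕ∞) F) (v w p : ℝ × ℝ × ℝ) :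
    fderiv ℝ (fun q => fderiv ℝ F q v) p w = fderiv ℝ (fun q => fderiv ℝ F q w) p v := by
  have hd : DifferentiableAt ℝ (fderiv ℝ F) p :=
    (h.fderiv_right (m := (⊤ : ℕ∞)) (by simp)).differentiable (by simp) p
  have key : ∀ v w, fderiv ℝ (fun q => fderiv ℝ F q v) p w = fderiv ℝ (fderiv ℝ F) p w v := by
    intro v w
    rw [fderiv_clm_apply hd (differentiableAt_const v)]
    simp
  rw [key, key]
  have hs : IsSymmSndFDerivAt ℝ F p := h.contDiffAt.isSymmSndFDerivAt (by
    simp only [minSmoothness_of_isRCLikeNormedField]; exact WithTop.coe_le_coe.mpr (le_top : (2 : ℕ∞) ≤ ⊤))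
  exact hs w v

lemma Sm.e1 {u : ℝ → ℝ → ℝ → ℝ} (h : Sm u) (r θ z : ℝ) : p1 u r θ z =
    fderiv ℝ (fun p : ℝ × ℝ × ℝ => u p.1 p.2.1 p.2.2) (r, θ, z) (1, 0, 0) := (h.has1 r θ z).deriv

lemma Sm.u1 {u : ℝ → ℝ → ℝ → ℝ} (h : Sm u) :
    (fun p : ℝ × ℝ × ℝ => p1 u p.1 p.2.1 p.2.2) =
    fun p => fderiv ℝ (fun p : ℝ × ℝ × ℝ => u p.1 p.2.1 p.2.2) p (1, 0, 0) :=
  funext fun p => h.e1 p.1 p.2.1 p.2.2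

lemma Sm.s1 {u : ℝ → ℝ → ℝ → ℝ} (h : Sm u) : Sm (p1 u) := by
  unfold Sm
  rw [h.u1]
  exact dir_smooth h _

lemma Sm.d1 {u : ℝ → ℝ → ℝ → ℝ} (h : Sm u) (r θ z : ℝ) :
    HasDerivAt (fun s => u s θ z) (p1 u r θ z) r := by
  rw [h.e1]; exact h.has1 r θ z

lemma Sm.e2 {u : ℝ → ℝ → ℝ → ℝ} (h : Sm u) (r θ z : ℝ) : p2 u r θ z =
    fderiv ℝ (fun p : ℝ × ℝ × ℝ => u p.1 p.2.1 p.2.2) (r, θ, z) (0, 1, 0) := (h.has2 r θ z).deriv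

lemma Sm.u2 {u : ℝ → ℝ → ℝ → ℝ} (h : Sm u) :
    (fun p : ℝ × ℝ × ℝ => p2 u p.1 p.2.1 p.2.2) =
    fun p => fderiv ℝ (fun p : ℝ × ℝ × ℝ => u p.1 p.2.1 p.2.2) p (0, 1, 0) :=
  funext fun p => h.e2 p.1 p.2.1 p.2.2

lemma Sm.s2 {u : ℝ → ℝ → ℝ → ℝ} (h : Sm u) : Sm (p2 u) := by
  unfold Sm
  rw [h.u2]
  exact dir_smooth h _

lemma Sm.d2 {u : ℝ → ℝ → ℝ → ℝ} (h : Sm u) (r θ z : ℝ) :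
    HasDerivAt (fun s => u r s z) (p2 u r θ z) θ := by
  rw [h.e2]; exact h.has2 r θ z

lemma Sm.e3 {u : ℝ → ℝ → ℝ → ℝ} (h : Sm u) (r θ z : ℝ) : p3 u r θ z =
    fderiv ℝ (fun p : ℝ × ℝ × ℝ => u p.1 p.2.1 p.2.2) (r, θ, z) (0, 0, 1) := (h.has3 r θ z).deriv

lemma Sm.u3 {u : ℝ → ℝ → ℝ → ℝ} (h : Sm u) :
    (fun p : ℝ × ℝ × ℝ => p3 u p.1 p.2.1 p.2.2) =
    fun p => fderiv ℝ (fun p : ℝ × ℝ × ℝ => u p.1 p.2.1 p.2.2) p (0, 0, 1) :=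
  funext fun p => h.e3 p.1 p.2.1 p.2.2

lemma Sm.s3 {u : ℝ → ℝ → ℝ → ℝ} (h : Sm u) : Sm (p3 u) := by
  unfold Sm
  rw [h.u3]
  exact dir_smooth h _

lemma Sm.d3 {u : ℝ → ℝ → ℝ → ℝ} (h : Sm u) (r θ z : ℝ) :
    HasDerivAt (fun s => u r θ s) (p3 u r θ z) z := by
  rw [h.e3]; exact h.has3 r θ z

lemma Sm.c21 {u : ℝ → ℝ → ℝ → ℝ} (h : Sm u) : p2 (p1 u) = p1 (p2 u) := by
  funext r θ z
  rw [h.s1.e2, h.s2.e1, h.u2, h.u1]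
  exact dir_comm h _ _ _

lemma Sm.c31 {u : ℝ → ℝ → ℝ → ℝ} (h : Sm u) : p3 (p1 u) = p1 (p3 u) := by
  funext r θ z
  rw [h.s1.e3, h.s3.e1, h.u3, h.u1]
  exact dir_comm h _ _ _

lemma Sm.c32 {u : ℝ → ℝ → ℝ → ℝ} (h : Sm u) : p3 (p2 u) = p2 (p3 u) := by
  funext r θ z
  rw [h.s2.e3, h.s3.e2, h.u3, h.u2]
  exact dir_comm h _ _ _

/-- The function obtained by applying the generator. -/
noncomputable def X7 (u : ℝ → ℝ → ℝ → ℝ) : ℝ → ℝ → ℝ → ℝ := fun r θ z =>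
  z * Real.sin θ * p1 u r θ z + (z * Real.cos θ / r) * p2 u r θ z
    - r * Real.sin θ * p3 u r θ z

lemma X7_1 {u : ℝ → ℝ → ℝ → ℝ} (h : Sm u) (r θ z : ℝ) (hr : 0 < r) :
    p1 (X7 u) r θ z = z * Real.sin θ * p1 (p1 u) r θ z + z * Real.cos θ / r * p1 (p2 u) r θ z
      - z * Real.cos θ / r ^ 2 * p2 u r θ z - Real.sin θ * p3 u r θ z
      - r * Real.sin θ * p1 (p3 u) r θ z := by
  have hr' := hr.ne'
  refine HasDerivAt.deriv ?_
  unfold X7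
  have := (((h.s1.d1 r θ z).const_mul (z * Real.sin θ)).add
    (((hasDerivAt_const r (z * Real.cos θ)).div (hasDerivAt_id r) hr').mul (h.s2.d1 r θ z))).sub
    (((hasDerivAt_id r).mul_const (Real.sin θ)).mul (h.s3.d1 r θ z))
  refine this.congr_deriv ?_
  simp only [id, Pi.div_apply]
  field_simp
  ring

lemma X7_11 {u : ℝ → ℝ → ℝ → ℝ} (h : Sm u) (r θ z : ℝ) (hr : 0 < r) :
    p1 (p1 (X7 u)) r θ z = z * Real.sin θ * p1 (p1 (p1 u)) r θ z
      + z * Real.cos θ / r * p1 (p1 (p2 u)) r θ z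
      - 2 * z * Real.cos θ / r ^ 2 * p1 (p2 u) r θ z
      + 2 * z * Real.cos θ / r ^ 3 * p2 u r θ z - 2 * Real.sin θ * p1 (p3 u) r θ z
      - r * Real.sin θ * p1 (p1 (p3 u)) r θ z := by
  have hr' := hr.ne'
  refine HasDerivAt.deriv ?_
  have := (((((h.s1.s1.d1 r θ z).const_mul (z * Real.sin θ)).add
    (((hasDerivAt_const r (z * Real.cos θ)).div (hasDerivAt_id r) hr').mul
      (h.s2.s1.d1 r θ z))).sub
    (((hasDerivAt_const r (z * Real.cos θ)).div (hasDerivAt_pow 2 r) (pow_ne_zero 2 hr')).mul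
      (h.s2.d1 r θ z))).sub ((h.s3.d1 r θ z).const_mul (Real.sin θ))).sub
    (((hasDerivAt_id r).mul_const (Real.sin θ)).mul (h.s3.s1.d1 r θ z))
  refine (this.congr_of_eventuallyEq ?_).congr_deriv ?_
  · filter_upwards [lt_mem_nhds hr] with s hs
    exact X7_1 h s θ z hs
  simp only [id, Pi.div_apply]
  field_simp
  ring

lemma X7_2 {u : ℝ → ℝ → ℝ → ℝ} (h : Sm u) (r θ z : ℝ) :
    p2 (X7 u) r θ z = z * Real.cos θ * p1 u r θ z + z * Real.sin θ * p2 (p1 u) r θ z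
      - z / r * Real.sin θ * p2 u r θ z + z / r * Real.cos θ * p2 (p2 u) r θ z
      - r * Real.cos θ * p3 u r θ z - r * Real.sin θ * p2 (p3 u) r θ z := by
  refine HasDerivAt.deriv ?_
  unfold X7
  have hs := Real.hasDerivAt_sin θ
  have hc := Real.hasDerivAt_cos θ
  have := (((hs.const_mul z).mul (h.s1.d2 r θ z)).add
    (((hc.const_mul z).div_const r).mul (h.s2.d2 r θ z))).sub
    ((hs.const_mul r).mul (h.s3.d2 r θ z))
  refine this.congr_deriv ?_
  ring

lemma X7_22 {u : ℝ → ℝ → ℝ → ℝ} (h : Sm u) (r θ z : ℝ) :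
    p2 (p2 (X7 u)) r θ z = - z * Real.sin θ * p1 u r θ z + 2 * z * Real.cos θ * p2 (p1 u) r θ z
      + z * Real.sin θ * p2 (p2 (p1 u)) r θ z
      - z / r * Real.cos θ * p2 u r θ z - 2 * z / r * Real.sin θ * p2 (p2 u) r θ z
      + z / r * Real.cos θ * p2 (p2 (p2 u)) r θ z
      + r * Real.sin θ * p3 u r θ z - 2 * r * Real.cos θ * p2 (p3 u) r θ z
      - r * Real.sin θ * p2 (p2 (p3 u)) r θ z := by
  refine HasDerivAt.deriv ?_
  simp only [X7_2 h]
  have hs := Real.hasDerivAt_sin θ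
  have hc := Real.hasDerivAt_cos θ
  have := ((((((hc.const_mul z).mul (h.s1.d2 r θ z)).add
    ((hs.const_mul z).mul (h.s1.s2.d2 r θ z))).sub
    ((hs.const_mul (z / r)).mul (h.s2.d2 r θ z))).add
    ((hc.const_mul (z / r)).mul (h.s2.s2.d2 r θ z))).sub
    ((hc.const_mul r).mul (h.s3.d2 r θ z))).sub
    ((hs.const_mul r).mul (h.s3.s2.d2 r θ z))
  refine this.congr_deriv ?_
  ring

lemma X7_3 {u : ℝ → ℝ → ℝ → ℝ} (h : Sm u) (r θ z : ℝ) :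
    p3 (X7 u) r θ z = Real.sin θ * p1 u r θ z + z * Real.sin θ * p3 (p1 u) r θ z
      + Real.cos θ / r * p2 u r θ z + z * (Real.cos θ / r) * p3 (p2 u) r θ z
      - r * Real.sin θ * p3 (p3 u) r θ z := by
  refine HasDerivAt.deriv ?_
  unfold X7
  have hz := hasDerivAt_id z
  have := (((hz.mul_const (Real.sin θ)).mul (h.s1.d3 r θ z)).add
    (((hz.mul_const (Real.cos θ)).div_const r).mul (h.s2.d3 r θ z))).sub
    ((h.s3.d3 r θ z).const_mul (r * Real.sin θ))
  refine this.congr_deriv ?_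
  simp only [id]
  ring

lemma X7_33 {u : ℝ → ℝ → ℝ → ℝ} (h : Sm u) (r θ z : ℝ) :
    p3 (p3 (X7 u)) r θ z = 2 * Real.sin θ * p3 (p1 u) r θ z
      + z * Real.sin θ * p3 (p3 (p1 u)) r θ z
      + 2 * Real.cos θ / r * p3 (p2 u) r θ z + z * (Real.cos θ / r) * p3 (p3 (p2 u)) r θ z
      - r * Real.sin θ * p3 (p3 (p3 u)) r θ z := by
  refine HasDerivAt.deriv ?_
  simp only [X7_3 h]
  have hz := hasDerivAt_id z
  have := (((((h.s1.d3 r θ z).const_mul (Real.sin θ)).add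
    ((hz.mul_const (Real.sin θ)).mul (h.s1.s3.d3 r θ z))).add
    ((h.s2.d3 r θ z).const_mul (Real.cos θ / r))).add
    ((hz.mul_const (Real.cos θ / r)).mul (h.s2.s3.d3 r θ z))).sub
    ((h.s3.s3.d3 r θ z).const_mul (r * Real.sin θ))
  refine this.congr_deriv ?_
  simp only [id]
  ring

lemma E_1 {k : ℝ} {u : ℝ → ℝ → ℝ → ℝ} (h : Sm u) (hu : ∀ r θ z : ℝ, 0 < r → CHEat k u r θ z)
    (r θ z : ℝ) (hr : 0 < r) :
    p1 (p1 (p1 u)) r θ z - 1 / r ^ 2 * p1 u r θ z + 1 / r * p1 (p1 u) r θ z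
      - 2 / r ^ 3 * p2 (p2 u) r θ z + 1 / r ^ 2 * p1 (p2 (p2 u)) r θ z
      + p1 (p3 (p3 u)) r θ z + k ^ 2 * p1 u r θ z = 0 := by
  have hr' := hr.ne'
  have := ((((h.s1.s1.d1 r θ z).add
    (((hasDerivAt_const r (1 : ℝ)).div (hasDerivAt_id r) hr').mul (h.s1.d1 r θ z))).add
    (((hasDerivAt_const r (1 : ℝ)).div (hasDerivAt_pow 2 r) (pow_ne_zero 2 hr')).mul
      (h.s2.s2.d1 r θ z))).add (h.s3.s3.d1 r θ z)).add ((h.d1 r θ z).const_mul (k ^ 2))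
  have h0 := this.unique ((hasDerivAt_const r (0 : ℝ)).congr_of_eventuallyEq (by
    filter_upwards [lt_mem_nhds hr] with s hs
    exact hu s θ z hs))
  rw [← h0]
  simp only [id, Pi.div_apply]
  field_simp
  ring

lemma E_2 {k : ℝ} {u : ℝ → ℝ → ℝ → ℝ} (h : Sm u) (hu : ∀ r θ z : ℝ, 0 < r → CHEat k u r θ z)
    (r θ z : ℝ) (hr : 0 < r) :
    p2 (p1 (p1 u)) r θ z + 1 / r * p2 (p1 u) r θ z + 1 / r ^ 2 * p2 (p2 (p2 u)) r θ z
      + p2 (p3 (p3 u)) r θ z + k ^ 2 * p2 u r θ z = 0 := by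
  have := ((((h.s1.s1.d2 r θ z).add ((h.s1.d2 r θ z).const_mul (1 / r))).add
    ((h.s2.s2.d2 r θ z).const_mul (1 / r ^ 2))).add (h.s3.s3.d2 r θ z)).add
    ((h.d2 r θ z).const_mul (k ^ 2))
  exact this.unique ((hasDerivAt_const θ (0 : ℝ)).congr_of_eventuallyEq
    (Filter.Eventually.of_forall fun s => hu r s z hr))

lemma E_3 {k : ℝ} {u : ℝ → ℝ → ℝ → ℝ} (h : Sm u) (hu : ∀ r θ z : ℝ, 0 < r → CHEat k u r θ z)
    (r θ z : ℝ) (hr : 0 < r) :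
    p3 (p1 (p1 u)) r θ z + 1 / r * p3 (p1 u) r θ z + 1 / r ^ 2 * p3 (p2 (p2 u)) r θ z
      + p3 (p3 (p3 u)) r θ z + k ^ 2 * p3 u r θ z = 0 := by
  have := ((((h.s1.s1.d3 r θ z).add ((h.s1.d3 r θ z).const_mul (1 / r))).add
    ((h.s2.s2.d3 r θ z).const_mul (1 / r ^ 2))).add (h.s3.s3.d3 r θ z)).add
    ((h.d3 r θ z).const_mul (k ^ 2))
  exact this.unique ((hasDerivAt_const z (0 : ℝ)).congr_of_eventuallyEq
    (Filter.Eventually.of_forall fun s => hu r θ s hr))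

/-- Infinitesimal invariance under `X₇ = z sin θ ∂_r + (z cos θ / r) ∂_θ − r sin θ ∂_z`:
if `u` solves the cylindrical Helmholtz equation with parameter `k`, then so does
`X₇u = z sin θ · u_r + (z cos θ / r) · u_θ − r sin θ · u_z` on the region `r > 0`. -/
theorem che_X7_infinitesimal_symmetry (k : ℝ) (u : ℝ → ℝ → ℝ → ℝ)
    (hu : SolvesCHE k u) :
    ∀ r θ z : ℝ, 0 < r →
      CHEat k (fun r θ z =>
        z * Real.sin θ * p1 u r θ z + (z * Real.cos θ / r) * p2 u r θ z
          - r * Real.sin θ * p3 u r θ z) r θ z := by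
  intro r θ z hr
  obtain ⟨h, hu⟩ := hu
  change Sm u at h
  change CHEat k (X7 u) r θ z
  have e1 := E_1 h hu r θ z hr
  have e2 := E_2 h hu r θ z hr
  have e3 := E_3 h hu r θ z hr
  unfold CHEat
  rw [X7_11 h r θ z hr, X7_1 h r θ z hr, X7_22 h, X7_33 h]
  simp only [X7]
  simp only [h.c21, h.c31, h.c32, h.s1.c21, h.s1.c31, h.s1.c32, h.s2.c21, h.s2.c31, h.s2.c32,
    h.s3.c21, h.s3.c31, h.s3.c32] at e1 e2 e3 ⊢
  have hi : r * r⁻¹ = 1 := mul_inv_cancel₀ hr.ne'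
  linear_combination (z * Real.sin θ) * e1 + (z * Real.cos θ / r) * e2
    - (r * Real.sin θ) * e3
    + (Real.sin θ * r⁻¹ * p3 u r θ z - 2 * Real.cos θ * r⁻¹ * p2 (p3 u) r θ z) * hi
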